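/- Let G be a finite group of order divisible by a prime p, and let χ be an irreducible complex character of G whose degree χ(1) is divisible by the p-part |G|_p of |G|. Then χ(g) = 0 for every element g ∈ G whose order is divisible by p. -/

import Mathlib

open CategoryTheory

theorem pow_dvd_sum_of_perm {X R : Type*} [Fintype X] [CommRing R] {p m n : ℕ} (hp : p.Prime)
    (σ : Equiv.Perm X) (hσ : ∀ x, σ^[p ^ n] x = x) (F : X → R) (hF : ∀ x, F (σ x) = F x)
    (h0 : ∀ x, σ^[p ^ m] x = x → F x = 0) : (p : R) ^ m ∣ ∑ x, F x := by
  classical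
  have hinv : ∀ (g : Subgroup.zpowers σ) (x : X), F (g • x) = F x := by
    have hsub : Subgroup.zpowers σ ≤
        { carrier := {g : Equiv.Perm X | ∀ x, F (g x) = F x}
          mul_mem' := fun {a b} ha hb x => (ha (b x)).trans (hb x)
          one_mem' := fun x => rfl
          inv_mem' := fun {a} ha x => by
            have := ha (a⁻¹ x)
            simpa using this.symm } := by
      rw [Subgroup.zpowers_le]
      exact hF
    exact fun g x => hsub g.2 x
  rw [← Finset.sum_fiberwise (s := Finset.univ)
    (g := fun x => (Quotient.mk'' x : MulAction.orbitRel.Quotient (Subgroup.zpowers σ) X))]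
  refine Finset.dvd_sum fun ω _ => ?_
  induction ω using Quotient.inductionOn' with | _ x
  have hset : (Finset.univ.filter fun y : X =>
      (Quotient.mk'' y : MulAction.orbitRel.Quotient (Subgroup.zpowers σ) X) = Quotient.mk'' x) =
      (MulAction.orbit (Subgroup.zpowers σ) x).toFinset := by
    ext y
    simp [Quotient.eq'', MulAction.orbitRel_apply]
  rw [hset, Finset.sum_congr rfl (g := fun _ => F x), Finset.sum_const, Set.toFinset_card,
    ← MulAction.minimalPeriod_eq_card, nsmul_eq_mul]
  · have hdvd : Function.minimalPeriod (σ • ·) x ∣ p ^ n :=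
      Function.IsPeriodicPt.minimalPeriod_dvd (hσ x)
    obtain ⟨j, -, hj⟩ := (Nat.dvd_prime_pow hp).1 hdvd
    rcases le_total j m with hjm | hjm
    · rw [h0 x, mul_zero]
      · exact dvd_zero _
      · have : Function.IsPeriodicPt (σ • ·) (p ^ m) x := by
          rw [Function.isPeriodicPt_iff_minimalPeriod_dvd, hj]
          exact pow_dvd_pow p hjm
        exact this
    · rw [hj, Nat.cast_pow]
      exact (pow_dvd_pow _ hjm).mul_right _
  · intro y hy
    rw [Set.mem_toFinset] at hy
    obtain ⟨g, rfl⟩ := hy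
    exact hinv g x

theorem sum_tuple_prod_of_convolution_idempotent {G R : Type*} [Group G] [Fintype G] [CommRing R]
    (e : G → R) (he : ∀ x, ∑ h, e h * e (h⁻¹ * x) = e x) (k : ℕ) (φ : G → R) :
    ∑ f : Fin (k + 1) → G, (∏ i, e (f i)) * φ (List.ofFn f).prod = ∑ x, e x * φ x := by
  induction k generalizing φ with
  | zero =>
    rw [← (Equiv.funUnique (Fin 1) G).symm.sum_comp]
    simp
  | succ k ih =>
    rw [← (Fin.consEquiv fun _ => G).sum_comp, Fintype.sum_prod_type]
    have step : ∀ h : G, ∑ f : Fin (k + 1) → G,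
        (∏ i, e ((Fin.consEquiv fun _ => G) (h, f) i)) *
          φ (List.ofFn ((Fin.consEquiv fun _ => G) (h, f))).prod =
        ∑ y, e h * e (h⁻¹ * y) * φ y := by
      intro h
      rw [← Equiv.sum_comp (Equiv.mulLeft h)]
      simp only [Equiv.coe_mulLeft, inv_mul_cancel_left, mul_assoc]
      rw [← Finset.mul_sum, ← ih (fun x => φ (h * x)), Finset.mul_sum]
      refine Finset.sum_congr rfl fun f _ => ?_
      rw [Fin.prod_univ_succ, List.ofFn_succ]
      simp [Fin.consEquiv, mul_assoc]
    simp_rw [step]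
    rw [Finset.sum_comm]
    simp_rw [← Finset.sum_mul, he]

theorem prod_range_mul_of_periodic {M : Type*} [Monoid M] (u : ℕ → M) (a : ℕ)
    (hu : ∀ i, u (i + a) = u i) (b : ℕ) :
    ((List.range (a * b)).map u).prod = ((List.range a).map u).prod ^ b := by
  have hu' : ∀ b i, u (a * b + i) = u i := by
    intro b
    induction b with
    | zero => simp
    | succ b ih => intro i; rw [← ih i, ← hu (a * b + i)]; congr 1; ring
  induction b with
  | zero => simp
  | succ b ih =>
    rw [Nat.mul_succ, List.range_add, List.map_append, List.prod_append, ih, pow_succ]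
    simp [Function.comp_def, hu']

theorem not_dvd_orderOf_pow_ordProj {G : Type*} [Group G] [Fintype G] {p : ℕ} (hp : p.Prime)
    (u : G) : ¬ p ∣ orderOf (u ^ p ^ (Fintype.card G).factorization p) := by
  intro h
  have h1 : orderOf (u ^ p ^ (Fintype.card G).factorization p) ∣
      Fintype.card G / p ^ (Fintype.card G).factorization p := by
    apply orderOf_dvd_of_pow_eq_one
    rw [← pow_mul, Nat.ordProj_mul_ordCompl_eq_self, pow_card_eq_one]
  exact Nat.not_dvd_ordCompl hp Fintype.card_ne_zero (h.trans h1)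

theorem List.prod_ofFn_eq_prod_range {M : Type*} [Monoid M] {q : ℕ} [NeZero q] (f : Fin q → M) :
    (List.ofFn f).prod = ((List.range q).map fun i => f (Fin.ofNat q i)).prod := by
  congr 1
  apply List.ext_getElem
  · simp
  · intro i h1 h2
    have : i < q := by simpa using h1
    simp [Fin.ofNat, Nat.mod_eq_of_lt this]

theorem pow_dvd_sum_conj_of_convolution_idempotent {G R : Type*} [Group G] [Fintype G]
    [CommRing R] {p : ℕ} (hp : p.Prime) (e : G → R)
    (he : ∀ x, ∑ h, e h * e (h⁻¹ * x) = e x) (φ : G → R)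
    (hφ : ∀ x y, φ (x * y) = φ (y * x)) (hφ0 : ∀ x, ¬ p ∣ orderOf x → φ x = 0) (m : ℕ) :
    (p : R) ^ m ∣ ∑ x, e x * φ x := by
  set a := (Fintype.card G).factorization p with ha
  have hq : p ^ (m + a) ≠ 0 := pow_ne_zero _ hp.ne_zero
  have : NeZero (p ^ (m + a)) := ⟨hq⟩
  have key : ∑ f : Fin (p ^ (m + a)) → G, (∏ i, e (f i)) * φ (List.ofFn f).prod =
      ∑ x, e x * φ x := by
    obtain ⟨k, hk⟩ := Nat.exists_eq_succ_of_ne_zero hq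
    rw [hk]
    exact sum_tuple_prod_of_convolution_idempotent e he k φ
  rw [← key]
  set σ : Equiv.Perm (Fin (p ^ (m + a)) → G) :=
    (Equiv.addRight (1 : Fin (p ^ (m + a)))).symm.arrowCongr (Equiv.refl G) with hσ
  have hσ1 : ∀ f i, σ f i = f (i + 1) := fun f i => rfl
  have hσk : ∀ k f i, (σ^[k] f) i = f (i + Fin.ofNat _ k) := by
    intro k
    induction k with
    | zero => intro f i; simp
    | succ k ih =>
      intro f i
      rw [Function.iterate_succ_apply, ih, hσ1, add_assoc]
      congr 2
      ext; simp [Fin.ofNat, Fin.val_add]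
  refine pow_dvd_sum_of_perm (n := m + a) hp σ ?_ _ ?_ ?_
  · intro f
    ext i
    rw [hσk]
    simp [Fin.ofNat]
  · intro f
    congr 1
    · exact Equiv.prod_comp (Equiv.addRight (1 : Fin (p ^ (m + a)))) fun i => e (f i)
    · have h1 : f 0 * (List.ofFn (σ f)).prod = (List.ofFn f).prod * f 0 := by
        rw [List.prod_ofFn_eq_prod_range, List.prod_ofFn_eq_prod_range]
        have h2 := List.prod_range_succ (fun i => f (Fin.ofNat _ i)) (p ^ (m + a))
        have h3 := List.prod_range_succ' (fun i => f (Fin.ofNat _ i)) (p ^ (m + a))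
        have e0 : Fin.ofNat (p ^ (m + a)) (p ^ (m + a)) = 0 := by ext; simp [Fin.ofNat]
        rw [h2, e0] at h3
        rw [h3]
        congr 3
        funext i
        rw [hσ1]
        congr 1
        ext; simp [Fin.ofNat, Fin.val_add]
      rw [← mul_inv_cancel_right (List.ofFn f).prod (f 0), ← h1, hφ, inv_mul_cancel_left]
  · intro f hf
    rw [hφ0, mul_zero]
    rw [List.prod_ofFn_eq_prod_range,
      show List.range (p ^ (m + a)) = List.range (p ^ m * p ^ a) by rw [pow_add], prod_range_mul_of_periodic]
    · exact not_dvd_orderOf_pow_ordProj hp _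
    · intro i
      conv_rhs => rw [← hf, hσk]
      congr 1
      ext; simp [Fin.ofNat, Fin.val_add]

theorem Representation.isIntegral_character {G V : Type*} [Group G] [Finite G] [AddCommGroup V]
    [Module ℂ V] [FiniteDimensional ℂ V] (ρ : Representation ℂ G V) (g : G) :
    IsIntegral ℤ (LinearMap.trace ℂ V (ρ g)) := by
  rw [Module.End.trace_eq_sum_roots_charpoly_of_splits (IsAlgClosed.splits _)]
  refine IsIntegral.multiset_sum fun μ hμ => ?_
  have hev : Module.End.HasEigenvalue (ρ g) μ := by
    rw [Module.End.hasEigenvalue_iff_isRoot_charpoly]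
    exact Polynomial.isRoot_of_mem_roots hμ
  obtain ⟨v, hv⟩ := hev.exists_hasEigenvector
  have h1 := hv.pow_apply (orderOf g)
  rw [← map_pow, pow_orderOf_eq_one, map_one, Module.End.one_apply] at h1
  have h2 : μ ^ orderOf g = 1 := by
    have : (μ ^ orderOf g - 1) • v = 0 := by rw [sub_smul, one_smul, ← h1, sub_self]
    exact sub_eq_zero.1 ((smul_eq_zero.1 this).resolve_right hv.2)
  refine IsIntegral.of_pow (orderOf_pos g) ?_
  rw [h2]; exact isIntegral_one

theorem FDRep.exists_eq_smul_one {G : Type} [Group G] (V : FDRep ℂ G) [Simple V]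
    (T : V →ₗ[ℂ] V) (hT : ∀ g, V.ρ g ∘ₗ T = T ∘ₗ V.ρ g) : ∃ c : ℂ, T = c • LinearMap.id := by
  have h1 : Module.finrank ℂ (Representation.invariants (Representation.linHom V.ρ V.ρ)) = 1 := by
    rw [(Representation.linHom.invariantsEquivFDRepHom V V).finrank_eq,
      FDRep.finrank_hom_simple_simple, if_pos ⟨Iso.refl V⟩]
  have hmem : ∀ S : V →ₗ[ℂ] V, (∀ g, V.ρ g ∘ₗ S = S ∘ₗ V.ρ g) →
      S ∈ Representation.invariants (Representation.linHom V.ρ V.ρ) := by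
    intro S hS g
    rw [Representation.linHom_apply, ← LinearMap.comp_assoc, hS, LinearMap.comp_assoc]
    change S * (V.ρ g * V.ρ g⁻¹) = S
    rw [← map_mul, mul_inv_cancel, map_one, mul_one]
  by_cases hid : (LinearMap.id : V →ₗ[ℂ] V) = 0
  · exact ⟨0, by rw [← LinearMap.comp_id T, hid]; simp⟩
  · obtain ⟨c, hc⟩ := (finrank_eq_one_iff_of_nonzero'
      (⟨LinearMap.id, hmem _ fun g => by simp⟩ :
        Representation.invariants (Representation.linHom V.ρ V.ρ))
      (fun h => hid (congrArg Subtype.val h))).1 h1 ⟨T, hmem T hT⟩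
    exact ⟨c, (congrArg Subtype.val hc).symm⟩

theorem FDRep.sum_char_inv_mul_char {G : Type} [Group G] [Fintype G] (V : FDRep ℂ G) [Simple V]
    (x : G) : (Module.finrank ℂ V : ℂ) * ∑ h, V.character h⁻¹ * V.character (h * x) =
      Fintype.card G * V.character x := by
  set T : V →ₗ[ℂ] V := ∑ h, V.character h⁻¹ • V.ρ h with hTdef
  have hT : ∀ g, V.ρ g * T = T * V.ρ g := by
    intro g
    rw [hTdef, Finset.mul_sum, Finset.sum_mul, ← Equiv.sum_comp (MulAut.conj g⁻¹).toEquiv]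
    refine Finset.sum_congr rfl fun h _ => ?_
    have e1 : (MulAut.conj g⁻¹).toEquiv h = g⁻¹ * h * g := by simp
    have e2 : V.character (g⁻¹ * h * g)⁻¹ = V.character h⁻¹ := by
      rw [← V.char_conj h⁻¹ g⁻¹]; congr 1; group
    rw [e1, e2, mul_smul_comm, smul_mul_assoc, ← map_mul, ← map_mul]
    congr 2; group
  obtain ⟨c, hc⟩ := V.exists_eq_smul_one T hT
  have htr : ∀ y, ∑ h, V.character h⁻¹ * V.character (h * y) = c * V.character y := by
    intro y
    have h1 : LinearMap.trace ℂ V (T * V.ρ y) = c * V.character y := by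
      rw [hc]
      change LinearMap.trace ℂ V ((c • (1 : Module.End ℂ V)) * V.ρ y) = _
      rw [smul_mul_assoc, one_mul, map_smul, smul_eq_mul]
      rfl
    rw [← h1, hTdef, Finset.sum_mul, map_sum]
    refine Finset.sum_congr rfl fun h _ => ?_
    rw [smul_mul_assoc, map_smul, smul_eq_mul, ← map_mul]
    rfl
  have hone := htr 1
  simp only [mul_one, FDRep.char_one] at hone
  have : Invertible (Nat.card G : ℂ) := invertibleOfNonzero (by simp)
  have horth := FDRep.char_orthonormal V V
  rw [if_pos ⟨Iso.refl V⟩, inv_mul_eq_one₀ (by simp), Nat.card_eq_fintype_card] at horth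
  rw [htr, ← mul_assoc, mul_comm _ c, ← hone, horth]
  congr 1
  exact Finset.sum_congr rfl fun h _ => mul_comm _ _

theorem eq_zero_of_forall_pow_dvd {R : Type*} [CommRing R] [IsDomain R] [IsNoetherianRing R]
    {a x : R} (ha : ¬ IsUnit a) (h : ∀ m : ℕ, a ^ m ∣ x) : x = 0 := by
  have h1 : x ∈ (⨅ i : ℕ, Ideal.span {a} ^ i) := by
    simp only [Ideal.mem_iInf, Ideal.span_singleton_pow, Ideal.mem_span_singleton]
    exact h
  rw [Ideal.iInf_pow_eq_bot_of_isDomain _ (by rwa [Ne, Ideal.span_singleton_eq_top])] at h1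
  exact h1

theorem not_isUnit_prime_of_adjoin {p d : ℕ} (hp : p.Prime) (hd : ¬ p ∣ d) (s : Set ℂ)
    (hs : ∀ z ∈ s, IsIntegral ℤ z) :
    ¬ IsUnit (p : Algebra.adjoin ℤ (insert ((d : ℂ)⁻¹) s)) := by
  have hd0 : (d : ℂ) ≠ 0 := by
    rintro h
    rw [Nat.cast_eq_zero] at h
    exact hd (h ▸ dvd_zero p)
  have hden : ∀ z ∈ Algebra.adjoin ℤ (insert ((d : ℂ)⁻¹) s),
      ∃ k : ℕ, IsIntegral ℤ ((d : ℂ) ^ k * z) := by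
    have hdi : ∀ k : ℕ, IsIntegral ℤ ((d : ℂ) ^ k) := fun k => by
      have := isIntegral_algebraMap (R := ℤ) (A := ℂ) (x := (d : ℤ) ^ k)
      simpa using this
    intro z hz
    induction hz using Algebra.adjoin_induction with
    | mem z hz =>
      rcases hz with rfl | hz
      · exact ⟨1, by rw [pow_one, mul_inv_cancel₀ hd0]; exact isIntegral_one⟩
      · exact ⟨0, by simpa using hs z hz⟩
    | algebraMap r => exact ⟨0, by simpa using isIntegral_algebraMap (R := ℤ) (A := ℂ) (x := r)⟩
    | add x y _ _ hx hy =>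
      obtain ⟨k, hk⟩ := hx
      obtain ⟨l, hl⟩ := hy
      refine ⟨k + l, ?_⟩
      rw [show (d : ℂ) ^ (k + l) * (x + y) = d ^ l * (d ^ k * x) + d ^ k * (d ^ l * y) by ring]
      exact ((hdi l).mul hk).add ((hdi k).mul hl)
    | mul x y _ _ hx hy =>
      obtain ⟨k, hk⟩ := hx
      obtain ⟨l, hl⟩ := hy
      refine ⟨k + l, ?_⟩
      rw [show (d : ℂ) ^ (k + l) * (x * y) = d ^ k * x * (d ^ l * y) by ring]
      exact hk.mul hl
  intro hu
  obtain ⟨b, hb⟩ := hu.exists_right_inv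
  obtain ⟨k, hk⟩ := hden b b.2
  have hb' : (p : ℂ) * (b : ℂ) = 1 := by
    simpa using congrArg Subtype.val hb
  have hp0 : (p : ℂ) ≠ 0 := Nat.cast_ne_zero.2 hp.ne_zero
  have hq : (d : ℂ) ^ k * (b : ℂ) = algebraMap ℚ ℂ ((d : ℚ) ^ k / p) := by
    rw [eq_inv_of_mul_eq_one_right hb']
    simp [div_eq_mul_inv]
  rw [hq, isIntegral_algebraMap_iff (algebraMap ℚ ℂ).injective] at hk
  obtain ⟨n, hn⟩ := IsIntegrallyClosed.isIntegral_iff.1 hk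
  have hp0' : (p : ℚ) ≠ 0 := Nat.cast_ne_zero.2 hp.ne_zero
  rw [eq_div_iff hp0'] at hn
  have hz : (n * p : ℤ) = (d : ℤ) ^ k := by
    have hn' : (n : ℚ) * p = (d : ℚ) ^ k := by simpa using hn
    exact_mod_cast hn'
  have hdvd : p ∣ d ^ k := by
    have : (p : ℤ) ∣ ((d ^ k : ℕ) : ℤ) := ⟨n, by push_cast; rw [← hz]; ring⟩
    exact_mod_cast this
  exact hd (hp.dvd_of_dvd_pow hdvd)

/-- Lemma 1.2 (defect-zero characters): if `χ` is an irreducible complex character of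
a finite group `G` with `|G|_p ∣ χ(1)`, where `p` is a prime dividing `|G|`, then
`χ(g) = 0` for every `p`-singular element `g`. -/
theorem defect_zero_char_vanishes_on_p_singular
    {G : Type} [Group G] [Fintype G] (p : ℕ) (hp : p.Prime)
    (hpG : p ∣ Fintype.card G)
    (V : FDRep ℂ G) (hV : Simple V)
    (hdeg : p ^ ((Fintype.card G).factorization p) ∣ Module.finrank ℂ V) :
    ∀ g : G, p ∣ orderOf g → V.character g = 0 := by
  classical
  intro g hg
  set q := p ^ (Fintype.card G).factorization p with hq
  set d := Fintype.card G / q with hd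
  have hqd : q * d = Fintype.card G := Nat.ordProj_mul_ordCompl_eq_self _ _
  have hpd : ¬ p ∣ d := Nat.not_dvd_ordCompl hp Fintype.card_ne_zero
  obtain ⟨b, hb⟩ := hdeg
  have hG0 : (Fintype.card G : ℂ) ≠ 0 := Nat.cast_ne_zero.2 Fintype.card_ne_zero
  have hqdC : (q : ℂ) * d = Fintype.card G := by exact_mod_cast hqd
  have hq0 : (q : ℂ) ≠ 0 := fun h => hG0 (by rw [← hqdC, h, zero_mul])
  have hd0 : (d : ℂ) ≠ 0 := fun h => hG0 (by rw [← hqdC, h, mul_zero])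
  have hbC : (Module.finrank ℂ V : ℂ) = q * b := by exact_mod_cast hb
  let R := Algebra.adjoin ℤ (insert ((d : ℂ)⁻¹) (Set.range V.character))
  have : Algebra.FiniteType ℤ R := (Subalgebra.fg_iff_finiteType R).1
    (Subalgebra.fg_def.2 ⟨_, (Set.finite_range _).insert _, rfl⟩)
  have : IsNoetherianRing R := Algebra.FiniteType.isNoetherianRing ℤ R
  have hpR : ¬ IsUnit (p : R) := by
    refine not_isUnit_prime_of_adjoin hp hpd _ ?_
    rintro _ ⟨h, rfl⟩
    exact Representation.isIntegral_character V.ρ h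
  have hmem : ∀ h, (b : ℂ) * (d : ℂ)⁻¹ * V.character h ∈ R := fun h =>
    mul_mem (mul_mem (natCast_mem R b) (Algebra.subset_adjoin (Set.mem_insert _ _)))
      (Algebra.subset_adjoin (Set.mem_insert_of_mem _ ⟨h, rfl⟩))
  let e : G → R := fun h => ⟨_, hmem h⟩
  have he : ∀ x, ∑ h, e h * e (h⁻¹ * x) = e x := by
    intro x
    apply Subtype.ext
    have h1 := V.sum_char_inv_mul_char x
    rw [← Equiv.sum_comp (Equiv.inv G), hbC, ← hqdC] at h1
    simp only [Equiv.inv_apply, inv_inv] at h1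
    have h2 : (b : ℂ) * ∑ h, V.character h * V.character (h⁻¹ * x) = d * V.character x :=
      mul_left_cancel₀ hq0 (by rw [← mul_assoc, h1, mul_assoc])
    push_cast
    simp only [e]
    calc _ = (b : ℂ) * (d : ℂ)⁻¹ * (d : ℂ)⁻¹ *
          ((b : ℂ) * ∑ h, V.character h * V.character (h⁻¹ * x)) := by
            rw [Finset.mul_sum, Finset.mul_sum]
            exact Finset.sum_congr rfl fun h _ => by ring
      _ = _ := by rw [h2]; field_simp
  let φ : G → R := fun x => if IsConj g x then 1 else 0
  have hsum : ∑ x, e x * φ x = 0 := by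
    refine eq_zero_of_forall_pow_dvd hpR
      (pow_dvd_sum_conj_of_convolution_idempotent hp e he φ ?_ ?_)
    · intro x y
      have hxy : IsConj (x * y) (y * x) := isConj_iff.2 ⟨x⁻¹, by group⟩
      simp only [φ]
      congr 1
      exact propext ⟨fun h => h.trans hxy, fun h => h.trans hxy.symm⟩
    · intro x hx
      refine if_neg fun h => hx ?_
      obtain ⟨c, rfl⟩ := isConj_iff.1 h
      have : orderOf (c * g * c⁻¹) = orderOf g := by
        rw [← MulAut.conj_apply]
        exact MulEquiv.orderOf_eq (MulAut.conj c) g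
      rwa [this]
  have hterm : ∀ x, e x * φ x = e g * φ x := by
    intro x
    by_cases h : IsConj g x
    · obtain ⟨c, rfl⟩ := isConj_iff.1 h
      congr 1
      apply Subtype.ext
      simp only [e, FDRep.char_conj]
    · simp only [φ, if_neg h, mul_zero]
  simp_rw [hterm, ← Finset.mul_sum] at hsum
  have : CharZero R := inferInstance
  have hcard : ∑ x, φ x ≠ 0 := by
    simp only [φ, Finset.sum_boole]
    rw [Nat.cast_ne_zero]
    exact Finset.card_ne_zero_of_mem (Finset.mem_filter.2 ⟨Finset.mem_univ g, IsConj.refl g⟩)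
  have heg : (b : ℂ) * (d : ℂ)⁻¹ * V.character g = 0 :=
    congrArg Subtype.val ((mul_eq_zero.1 hsum).resolve_right hcard)
  rcases mul_eq_zero.1 heg with h | h
  · have hb0 : (b : ℂ) = 0 := (mul_eq_zero.1 h).resolve_right (inv_ne_zero hd0)
    have h1 := V.sum_char_inv_mul_char g
    rw [hbC, hb0, mul_zero, zero_mul] at h1
    exact (mul_eq_zero.1 h1.symm).resolve_left hG0
  · exact h
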